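/- For τ > 0, a_L < 0 and 0 < a_R ≤ −a_L: √2·a_L ∫₀^∞ (1/√(z+τ)) · e^{−(a_L z − a_R τ)²/(2(z+τ))} · erfc(−(a_L+a_R)√(zτ)/√(2(z+τ))) dz = −2√π · e^{2a_L(a_L+a_R)τ} · erfc(−(2a_L+a_R)√τ/√2). -/

import Mathlib

open Real MeasureTheory

/-- The complementary error function. -/
noncomputable def erfc (x : ℝ) : ℝ :=
  (2 / Real.sqrt π) * ∫ u in Set.Ioi x, Real.exp (-u^2)

open Set Filter Topology in
lemma phi_top : Tendsto (fun x : ℝ => ∫ u in (0:ℝ)..x, Real.exp (-(1/2) * u^2)) atTop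
    (𝓝 (√(2 * π) / 2)) := by
  have h := intervalIntegral_tendsto_integral_Ioi (μ := volume) (l := atTop) (b := fun x : ℝ => x)
    0 (integrable_exp_neg_mul_sq (b := 1/2) (by norm_num)).integrableOn tendsto_id
  rw [integral_gaussian_Ioi] at h
  convert h using 4
  ring

open Set Filter Topology in
lemma phi_bot : Tendsto (fun x : ℝ => ∫ u in (0:ℝ)..x, Real.exp (-(1/2) * u^2)) atBot
    (𝓝 (-(√(2 * π) / 2))) := by
  have h := (phi_top.comp tendsto_neg_atBot_atTop).neg
  refine h.congr fun x => ?_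
  have := intervalIntegral.integral_comp_neg (a := 0) (b := x)
    (fun u : ℝ => Real.exp (-(1/2) * u^2))
  simp only [neg_sq, neg_zero] at this
  simp only [Function.comp]
  rw [this, ← intervalIntegral.integral_symm]

lemma phi_deriv (x : ℝ) : HasDerivAt (fun x : ℝ => ∫ u in (0:ℝ)..x, Real.exp (-(1/2) * u^2))
    (Real.exp (-(1/2) * x^2)) x := by
  have hc : Continuous (fun u : ℝ => Real.exp (-(1/2) * u^2)) := by fun_prop
  exact hc.deriv_integral _ 0 x ▸ (intervalIntegral.differentiable_integral_of_continuous hc x).hasDerivAt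

open Set Filter Topology in
lemma glasser (A t : ℝ) (hA : 0 < A) (ht : 0 < t) :
    ∫ y in Ioi (0:ℝ), Real.exp (-(A^2 * y^2 / 2) - t^2 / (2 * y^2))
      = √(2 * π) / (2 * A) * Real.exp (-(A * t)) := by
  set Φ : ℝ → ℝ := fun x : ℝ => ∫ u in (0:ℝ)..x, Real.exp (-(1/2) * u^2) with hΦ
  have hfi : IntegrableOn (fun y : ℝ => Real.exp (-(A^2 * y^2 / 2) - t^2 / (2 * y^2)))
      (Ioi 0) := by
    refine Integrable.mono' (integrable_exp_neg_mul_sq (b := A^2/2) (by positivity)).integrableOn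
      ?_ ?_
    · exact Measurable.aestronglyMeasurable (by fun_prop)
    · refine Eventually.of_forall fun y => ?_
      rw [Real.norm_eq_abs, abs_of_pos (Real.exp_pos _)]
      apply Real.exp_le_exp.2
      have : 0 ≤ t^2 / (2 * y^2) := by positivity
      linarith
  have hd : ∀ y ∈ Ioi (0:ℝ), HasDerivAt
      (fun y => Real.exp (A*t) * Φ (A*y + t*y⁻¹) + Real.exp (-(A*t)) * Φ (A*y - t*y⁻¹))
      (2 * A * Real.exp (-(A^2 * y^2 / 2) - t^2 / (2 * y^2))) y := by
    intro y hy
    have hy0 : y ≠ 0 := ne_of_gt hy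
    have h1 : HasDerivAt (fun y : ℝ => A*y + t*y⁻¹) (A*1 + t*(-(y^2)⁻¹)) y :=
      ((hasDerivAt_id y).const_mul A).add ((hasDerivAt_inv hy0).const_mul t)
    have h2 : HasDerivAt (fun y : ℝ => A*y - t*y⁻¹) (A*1 - t*(-(y^2)⁻¹)) y :=
      ((hasDerivAt_id y).const_mul A).sub ((hasDerivAt_inv hy0).const_mul t)
    have h3 := (((phi_deriv (A*y + t*y⁻¹)).comp y h1).const_mul (Real.exp (A*t))).add
      (((phi_deriv (A*y - t*y⁻¹)).comp y h2).const_mul (Real.exp (-(A*t))))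
    refine h3.congr_deriv ?_
    rw [← mul_assoc, ← mul_assoc, ← Real.exp_add, ← Real.exp_add]
    have e1 : A*t + -(1/2) * (A*y + t*y⁻¹)^2 = -(A^2 * y^2 / 2) - t^2 / (2 * y^2) := by
      field_simp; ring
    have e2 : -(A*t) + -(1/2) * (A*y - t*y⁻¹)^2 = -(A^2 * y^2 / 2) - t^2 / (2 * y^2) := by
      field_simp; ring
    rw [e1, e2]; ring
  have hAy : Tendsto (fun y : ℝ => A * y) atTop atTop := tendsto_id.const_mul_atTop hA
  have hinv : Tendsto (fun y : ℝ => t * y⁻¹) atTop (𝓝 0) := by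
    simpa using tendsto_inv_atTop_zero.const_mul t
  have hAy0 : Tendsto (fun y : ℝ => A * y) (𝓝[>] 0) (𝓝 0) := by
    have : Continuous (fun y : ℝ => A * y) := by fun_prop
    simpa using (this.tendsto 0).mono_left nhdsWithin_le_nhds
  have hinv0 : Tendsto (fun y : ℝ => t * y⁻¹) (𝓝[>] 0) atTop :=
    tendsto_inv_nhdsGT_zero.const_mul_atTop ht
  have ht1 : Tendsto (fun y => Real.exp (A*t) * Φ (A*y + t*y⁻¹)
      + Real.exp (-(A*t)) * Φ (A*y - t*y⁻¹)) atTop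
      (𝓝 (Real.exp (A*t) * (√(2 * π) / 2) + Real.exp (-(A*t)) * (√(2 * π) / 2))) := by
    refine ((phi_top.comp (hAy.atTop_add hinv)).const_mul _).add
      ((phi_top.comp ?_).const_mul _)
    simpa [sub_eq_add_neg] using hAy.atTop_add hinv.neg
  have ht0 : Tendsto (fun y => Real.exp (A*t) * Φ (A*y + t*y⁻¹)
      + Real.exp (-(A*t)) * Φ (A*y - t*y⁻¹)) (𝓝[>] 0)
      (𝓝 (Real.exp (A*t) * (√(2 * π) / 2) + Real.exp (-(A*t)) * (-(√(2 * π) / 2)))) := by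
    refine ((phi_top.comp (hAy0.add_atTop hinv0)).const_mul _).add
      ((phi_bot.comp ?_).const_mul _)
    simpa [sub_eq_add_neg] using hAy0.add_atBot (tendsto_neg_atTop_atBot.comp hinv0)
  have key := integral_Ioi_deriv_mul_eq_sub (a := (0:ℝ)) (A := ℝ) (v := fun _ => 1)
    (v' := fun _ => 0) hd
    (fun x _ => hasDerivAt_const x 1) (by
      have : IntegrableOn _ _ volume := hfi.const_mul (2*A)
      refine this.congr_fun (fun y _ => ?_) measurableSet_Ioi
      simp) (by simpa [Pi.mul_def] using ht0) (by simpa [Pi.mul_def] using ht1)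
  simp only [mul_one, mul_zero, add_zero] at key
  rw [integral_const_mul] at key
  rw [Real.sqrt_mul (by norm_num)]
  generalize (∫ y in Ioi (0:ℝ), (_ : ℝ)) = Y at key ⊢
  field_simp
  linear_combination key

open Set in
lemma erfc_eq (x k : ℝ) (hk : 0 < k) :
    erfc x = 2 / √π * k * ∫ t in Ioi (0:ℝ), Real.exp (-(x + k * t)^2) := by
  have h1 := integral_comp_mul_left_Ioi (fun s : ℝ => Real.exp (-(x + s)^2)) 0 hk
  have h2 : ∫ s in Ioi (0:ℝ), Real.exp (-(x + s)^2) = ∫ u in Ioi x, Real.exp (-u^2) := by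
    have := (measurePreserving_add_left (volume : Measure ℝ) x).setIntegral_preimage_emb
      (measurableEmbedding_addLeft x) (fun u : ℝ => Real.exp (-u^2)) (Ioi x)
    rw [← this]; simp
  rw [mul_zero, h2] at h1
  rw [h1, erfc, smul_eq_mul]
  field_simp

open Set in
lemma swap_int (A C : ℝ) (hA : 0 < A) (hC : 0 ≤ C) :
    ∫ y in Ioi (0:ℝ), ∫ t in Ioi (0:ℝ),
        Real.exp (-(A^2 * y^2 / 2) - t^2 / (2 * y^2)) * Real.exp (-(t^2/2) - C * t)
      = √(2 * π) / (2 * A) * ∫ t in Ioi (0:ℝ), Real.exp (-(t^2/2) - (A + C) * t) := by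
  rw [integral_integral_swap]
  · rw [← integral_const_mul]
    refine setIntegral_congr_fun measurableSet_Ioi fun t ht => ?_
    rw [integral_mul_const, glasser A t hA ht, mul_assoc, ← Real.exp_add]
    congr 2; ring
  · have hb : Integrable (fun z : ℝ × ℝ => Real.exp (-(A^2/2) * z.1^2) * Real.exp (-(1/2) * z.2^2))
        ((volume.restrict (Ioi 0)).prod (volume.restrict (Ioi 0))) :=
      Integrable.mul_prod (f := fun y : ℝ => Real.exp (-(A^2/2) * y^2))
        (g := fun y : ℝ => Real.exp (-(1/2) * y^2))
        (integrable_exp_neg_mul_sq (by positivity)).integrableOn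
        (integrable_exp_neg_mul_sq (by positivity)).integrableOn
    refine hb.mono' (Measurable.aestronglyMeasurable (by unfold Function.uncurry; fun_prop)) ?_
    rw [Measure.prod_restrict]
    refine (ae_restrict_iff' (measurableSet_Ioi.prod measurableSet_Ioi)).2 ?_
    refine Filter.Eventually.of_forall fun z hz => ?_
    have hz2 : 0 < z.2 := hz.2
    simp only [Function.uncurry]
    rw [Real.norm_eq_abs, abs_of_pos (by positivity)]
    have : 0 ≤ z.2^2 / (2 * z.1^2) := by positivity
    have : 0 ≤ C * z.2 := by positivity
    gcongr <;> linarith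

open Set in
lemma inner_eq (a c τ y : ℝ) (hτ : 0 < τ) (hy : 0 < y) :
    (2 * τ * y) * ((1 / √(τ * y^2 + τ)) *
          Real.exp (-(-a * (τ * y^2) - (a - c) * τ)^2 / (2 * (τ * y^2 + τ))) *
          erfc (c * √((τ * y^2) * τ) / √(2 * (τ * y^2 + τ))))
    = (4 * √τ / (√2 * √π) * Real.exp (-(a - c)^2 * τ / 2)) *
      ∫ t in Ioi (0:ℝ), Real.exp (-((a * √τ)^2 * y^2 / 2) - t^2 / (2 * y^2)) *
        Real.exp (-(t^2/2) - (c * √τ) * t) := by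
  obtain ⟨r, hr, rfl⟩ : ∃ r : ℝ, 0 < r ∧ τ = r^2 :=
    ⟨√τ, Real.sqrt_pos.2 hτ, (Real.sq_sqrt hτ.le).symm⟩
  have hq0 : 0 < y^2 + 1 := by positivity
  set q := √(y^2+1) with hq
  have hqp : 0 < q := Real.sqrt_pos.2 hq0
  have hqq : q^2 = y^2 + 1 := Real.sq_sqrt hq0.le
  have h2 : 0 < √2 := by positivity
  have h22 : √2^2 = 2 := Real.sq_sqrt (by norm_num)
  have s1 : √(r^2 * y^2 + r^2) = r * q := by
    rw [Real.sqrt_eq_iff_eq_sq (by positivity) (by positivity), mul_pow, hqq]; ring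
  have s2 : √(r^2 * y^2 * r^2) = r^2 * y := by
    rw [Real.sqrt_eq_iff_eq_sq (by positivity) (by positivity)]; ring
  have s3 : √(2 * (r^2 * y^2 + r^2)) = √2 * (r * q) := by
    rw [Real.sqrt_mul (by norm_num), s1]
  have s4 : √(r^2) = r := Real.sqrt_sq hr.le
  rw [s1, s2, s3, s4, erfc_eq _ (q / (√2 * y)) (by positivity)]
  have e : ∀ t : ℝ, Real.exp (-(-a * (r^2 * y^2) - (a - c) * r^2)^2 / (2 * (r^2 * y^2 + r^2))) *
      Real.exp (-(c * (r^2 * y) / (√2 * (r * q)) + q / (√2 * y) * t)^2) =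
      Real.exp (-(a - c)^2 * r^2 / 2) * (Real.exp (-((a * r)^2 * y^2 / 2) - t^2 / (2 * y^2)) *
        Real.exp (-(t^2/2) - (c * r) * t)) := by
    intro t
    rw [← Real.exp_add, ← Real.exp_add, ← Real.exp_add]
    congr 1
    have : (c * (r^2 * y) / (√2 * (r * q)) + q / (√2 * y) * t)^2
        = c^2 * r^2 * y^2 / (2 * (y^2+1)) + c * r * t + (y^2+1) * t^2 / (2 * y^2) := by
      rw [← hqq]
      field_simp
      rw [h22]; ring
    rw [this]
    field_simp
    ring
  have E := integral_const_mul (μ := volume.restrict (Ioi (0:ℝ)))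
    (Real.exp (-(-a * (r^2 * y^2) - (a - c) * r^2)^2 / (2 * (r^2 * y^2 + r^2))))
    (fun t : ℝ => Real.exp (-(c * (r^2 * y) / (√2 * (r * q)) + q / (√2 * y) * t)^2))
  simp only [e] at E
  rw [integral_const_mul] at E
  have hpi : √π ≠ 0 := by positivity
  calc _ = (4 * r / (√2 * √π)) * (Real.exp (-(-a * (r^2 * y^2) - (a - c) * r^2)^2 / (2 * (r^2 * y^2 + r^2))) * ∫ t in Ioi (0:ℝ), Real.exp (-(c * (r^2 * y) / (√2 * (r * q)) + q / (√2 * y) * t)^2)) := by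
        generalize Real.exp _ = X
        generalize (∫ t in Ioi (0:ℝ), (_ : ℝ)) = Y
        field_simp
        ring
    _ = _ := by rw [← E]; ring

open Set in
lemma subst_sq (τ : ℝ) (hτ : 0 < τ) (g : ℝ → ℝ) :
    ∫ z in Ioi (0:ℝ), g z = ∫ y in Ioi (0:ℝ), (2 * τ * y) * g (τ * y^2) := by
  have h1 := integral_comp_mul_left_Ioi g 0 hτ
  have h2 := integral_comp_rpow_Ioi_of_pos (g := fun z => g (τ * z)) (p := 2) (by norm_num)
  rw [mul_zero] at h1
  rw [h1] at h2
  have h3 : ∫ z in Ioi (0:ℝ), g z = τ * (τ⁻¹ • ∫ z in Ioi (0:ℝ), g z) := by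
    rw [smul_eq_mul]; field_simp
  rw [h3, ← h2, ← integral_const_mul]
  refine setIntegral_congr_fun measurableSet_Ioi fun y hy => ?_
  have : (2:ℝ) - 1 = 1 := by norm_num
  simp only [this, Real.rpow_one, Real.rpow_two, smul_eq_mul]
  ring

/-- integral identity for the long-time asymptotics. -/
theorem stmt12 (aL aR τ : ℝ) (hτ : 0 < τ) (hL : aL < 0)
    (hR0 : 0 < aR) (hR : aR ≤ -aL) :
    Real.sqrt 2 * aL *
      ∫ z in Set.Ioi (0:ℝ),
        (1 / Real.sqrt (z + τ)) *
          Real.exp (-(aL * z - aR * τ)^2 / (2 * (z + τ))) *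
          erfc (-(aL + aR) * Real.sqrt (z * τ) / Real.sqrt (2 * (z + τ)))
    = -2 * Real.sqrt π * Real.exp (2 * aL * (aL + aR) * τ) *
        erfc (-(2*aL + aR) * Real.sqrt τ / Real.sqrt 2) := by
  obtain ⟨a, rfl⟩ : ∃ a, aL = -a := ⟨-aL, by ring⟩
  obtain ⟨c, rfl⟩ : ∃ c, aR = a - c := ⟨a - aR, by ring⟩
  have ha : 0 < a := by linarith
  have hc : 0 ≤ c := by linarith
  have i1 : -(-a + (a - c)) = c := by ring
  have i2 : -(2 * -a + (a - c)) = a + c := by ring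
  have i3 : 2 * -a * (-a + (a - c)) * τ = 2 * a * c * τ := by ring
  rw [i1, i2, i3, subst_sq τ hτ]
  rw [setIntegral_congr_fun measurableSet_Ioi fun y hy => inner_eq a c τ y hτ hy]
  have hr : 0 < √τ := Real.sqrt_pos.2 hτ
  have hrr : √τ^2 = τ := Real.sq_sqrt hτ.le
  have h2 : 0 < √2 := by positivity
  have h22 : √2^2 = 2 := Real.sq_sqrt (by norm_num)
  have hpi : √π ≠ 0 := by positivity
  rw [integral_const_mul, swap_int (a * √τ) (c * √τ) (by positivity) (by positivity),
    erfc_eq _ (1 / √2) (by positivity)]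
  have e : ∀ t : ℝ, Real.exp (-((a + c) * √τ / √2 + 1 / √2 * t)^2) =
      Real.exp (-(a + c)^2 * τ / 2) * Real.exp (-(t^2/2) - (a * √τ + c * √τ) * t) := by
    intro t
    rw [← Real.exp_add]
    congr 1
    rw [← hrr]
    field_simp
    simp only [Real.sqrt_sq hr.le, h22]
    ring
  simp only [e]
  rw [integral_const_mul]
  have e2 : Real.exp (-(a - c)^2 * τ / 2)
      = Real.exp (2 * a * c * τ) * Real.exp (-(a + c)^2 * τ / 2) := by
    rw [← Real.exp_add]; congr 1; ring
  rw [e2, Real.sqrt_mul (by norm_num)]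
  generalize Real.exp (2 * a * c * τ) = X
  generalize Real.exp (-(a + c)^2 * τ / 2) = Z
  generalize (∫ t in Set.Ioi (0:ℝ), (_ : ℝ)) = Y
  field_simp
  try rw [h22]
  try ring
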